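/- Let m > 1, let A₁,…,A_m be n×n invertible real matrices with A_i − A_j invertible for i ≠ j, let 0 ≤ α < n, and let T_α be the integral operator with kernel k(x,y) = |x−A₁y|^{−α₁} ⋯ |x−A_m y|^{−α_m}, where α₁,…,α_m > 0 and α₁+⋯+α_m = n − α. Let p : ℝⁿ → (0,∞) satisfy the local log-Hölder condition and the log-Hölder condition at infinity, 0 < p₋ ≤ p₊ < n/α, and p(A_i x) = p(x) for all x and all i; define q by 1/q(x) = 1/p(x) − α/n. Let max(1,p₊) < p₀ < n/α, 1/q₀ = 1/p₀ − α/n, d ≥ d_{p(·)} an integer, and D = max_i ‖A_i‖. Then there is a constant C, independent of the atom, such that for every (p(·),p₀,d)-atom a supported in a cube Q = Q(z,r) and every 1 ≤ i ≤ m, setting Q_i* = Q(A_i z, 4Dr), one has ‖T_α a‖_{L^{q₀}(Q_i*)} ≤ C |Q_i*|^{1/q₀} / ‖χ_{Q_i*}‖_{q(·)}. -/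

import Mathlib

open MeasureTheory ENNReal

noncomputable section

abbrev Rn (n : ℕ) := EuclideanSpace ℝ (Fin n)

/-- The variable exponent Lebesgue quasinorm of an `ℝ≥0∞`-valued function. -/
def varLpNormE {n : ℕ} (p : Rn n → ℝ) (g : Rn n → ℝ≥0∞) : ℝ≥0∞ :=
  sInf {l : ℝ≥0∞ | ∃ lam : ℝ, 0 < lam ∧ l = ENNReal.ofReal lam ∧
    (∫⁻ x, (g x / ENNReal.ofReal lam) ^ (p x)) ≤ 1}

/-- The variable exponent Lebesgue quasinorm `‖f‖_{p(·)}`. -/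
def varLpNorm {n : ℕ} (p : Rn n → ℝ) (f : Rn n → ℝ) : ℝ≥0∞ :=
  varLpNormE p (fun x => ENNReal.ofReal |f x|)

/-- The local log-Hölder continuity condition. -/
def LogHolderLocal {n : ℕ} (p : Rn n → ℝ) : Prop :=
  ∃ c > 0, ∀ x y : Rn n, ‖x - y‖ < 1/2 → |p x - p y| ≤ c / (-Real.log ‖x - y‖)

/-- The log-Hölder condition at infinity. -/
def LogHolderInfty {n : ℕ} (p : Rn n → ℝ) : Prop :=
  ∃ C > 0, ∃ pinf : ℝ, ∀ x : Rn n, |p x - pinf| ≤ C / Real.log (Real.exp 1 + ‖x‖)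

/-- The (closed) cube centered at `z` with side length `r`. -/
def cube {n : ℕ} (z : Rn n) (r : ℝ) : Set (Rn n) := {x | ∀ i, |x i - z i| ≤ r / 2}

/-- The characteristic function of the cube `Q(z,r)`. -/
def cubeInd {n : ℕ} (z : Rn n) (r : ℝ) : Rn n → ℝ := Set.indicator (cube z r) 1

/-- The fractional maximal operator `M_β`. -/
def fracMax {n : ℕ} (β : ℝ) (f : Rn n → ℝ) (x : Rn n) : ℝ :=
  ⨆ (z : Rn n) (r : ℝ) (_ : 0 < r) (_ : x ∈ cube z r),
    (volume (cube z r)).toReal ^ (β / (n : ℝ) - 1) * ∫ y in cube z r, |f y|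

/-- `p̲ = min (p₋, 1)`. -/
def pUnder {n : ℕ} (p : Rn n → ℝ) : ℝ := min (⨅ x, p x) 1

/-- The quantity `𝒜({λ_j},{Q_j},p(·))`. -/
def AFun {n : ℕ} (p : Rn n → ℝ) (lam : ℕ → ℝ) (z : ℕ → Rn n) (r : ℕ → ℝ) : ℝ≥0∞ :=
  varLpNorm p (fun x =>
    (∑' j, (lam j * cubeInd (z j) (r j) x /
        (varLpNorm p (cubeInd (z j) (r j))).toReal) ^ pUnder p) ^ (1 / pUnder p))

/-- `d_{p(·)} = min {ℓ ∈ ℕ : p₋ (n + ℓ + 1) > n}` where `t` plays the role of `p₋`. -/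
def dIndex (n : ℕ) (t : ℝ) : ℕ := sInf {l : ℕ | t * (n + l + 1) > n}

/-- `p₋`, the essential lower bound of the exponent. -/
def pLow {n : ℕ} (p : Rn n → ℝ) : ℝ := ⨅ x, p x

/-- A `(p(·), p₀, d)`-atom supported in the cube `Q(z,r)`. -/
structure IsPAtom {n : ℕ} (p : Rn n → ℝ) (p₀ : ℝ) (d : ℕ) (a : Rn n → ℝ)
    (z : Rn n) (r : ℝ) : Prop where
  measurable : Measurable a
  support : ∀ x, x ∉ cube z r → a x = 0
  size : eLpNorm a (ENNReal.ofReal p₀) volume ≤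
    ENNReal.ofReal ((volume (cube z r)).toReal ^ (1 / p₀)) / varLpNorm p (cubeInd z r)
  moments : ∀ γ : Fin n → ℕ, (∑ i, γ i) ≤ d → ∫ x, a x * ∏ i, x i ^ γ i = 0

/-- Action of an `n × n` matrix on `ℝⁿ`. -/
def mApp {n : ℕ} (A : Matrix (Fin n) (Fin n) ℝ) (x : Rn n) : Rn n :=
  Matrix.toEuclideanLin A x

/-- The operator norm of a matrix acting on Euclidean space. -/
def opNorm {n : ℕ} (A : Matrix (Fin n) (Fin n) ℝ) : ℝ :=
  ‖Matrix.toEuclideanCLM (𝕜 := ℝ) A‖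

/-- The kernel `k(x,y) = |x - A₁ y|^{-α₁} ⋯ |x - A_m y|^{-α_m}`. -/
def kern {n m : ℕ} (A : Fin m → Matrix (Fin n) (Fin n) ℝ) (αe : Fin m → ℝ)
    (x y : Rn n) : ℝ :=
  ∏ i, ‖x - mApp (A i) y‖ ^ (-(αe i))

/-- The fractional type integral operator `T_α`. -/
def Tα {n m : ℕ} (A : Fin m → Matrix (Fin n) (Fin n) ℝ) (αe : Fin m → ℝ)
    (f : Rn n → ℝ) (x : Rn n) : ℝ :=
  ∫ y, kern A αe x y * f y

/-- The Riesz potential `I_α`. -/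
def riesz {n : ℕ} (α : ℝ) (f : Rn n → ℝ) (x : Rn n) : ℝ :=
  ∫ y, ‖x - y‖ ^ (α - (n : ℝ)) * f y

/-- Partial derivative in the `i`-th coordinate direction. -/
def pderiv1 {n : ℕ} (i : Fin n) (g : Rn n → ℝ) : Rn n → ℝ :=
  fun x => fderiv ℝ g x (EuclideanSpace.single i 1)

/-- The multiindex partial derivative `∂^γ`. -/
def mderiv {n : ℕ} (γ : Fin n → ℕ) (g : Rn n → ℝ) : Rn n → ℝ :=
  (List.finRange n).foldr (fun i h => (pderiv1 i)^[γ i] h) g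

/-- The finite set of multiindices `γ` with `|γ| ≤ N`. -/
def multiIndices (n N : ℕ) : Finset (Fin n → ℕ) :=
  (Fintype.piFinset fun _ => Finset.range (N+1)).filter (fun γ => (∑ i, γ i) ≤ N)

/-- The family `F_N` of normalized Schwartz test functions. -/
def FN (n N : ℕ) : Set (SchwartzMap (Rn n) ℝ) :=
  {φ | (∑ γ ∈ multiIndices n N, ⨆ x : Rn n, (1 + ‖x‖) ^ N * |mderiv γ (⇑φ) x|) ≤ 1}

/-- The grand maximal function `𝓜 f`. -/
def grandMax (n N : ℕ) (f : Rn n → ℝ) (x : Rn n) : ℝ≥0∞ :=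
  ⨆ (t : ℝ) (_ : 0 < t) (φ : FN n N),
    ENNReal.ofReal |∫ y, t ^ (-(n : ℝ)) * (φ : SchwartzMap (Rn n) ℝ) (t⁻¹ • (x - y)) * f y|

/-- The variable Hardy space quasinorm `‖f‖_{H^{p(·)}}` (with parameter `N`). -/
def hardyNorm {n : ℕ} (p : Rn n → ℝ) (N : ℕ) (f : Rn n → ℝ) : ℝ≥0∞ :=
  varLpNormE p (grandMax n N f)

/-- `γ! = γ₁! ⋯ γ_n!`. -/
def mfact {n : ℕ} (γ : Fin n → ℕ) : ℕ := ∏ i, (γ i).factorial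

/-- The degree-`d` Taylor polynomial of `g` at `z`, evaluated at `y`. -/
def taylorPoly {n : ℕ} (d : ℕ) (g : Rn n → ℝ) (z y : Rn n) : ℝ :=
  ∑ γ ∈ multiIndices n d, (mderiv γ g z / (mfact γ : ℝ)) * ∏ i, (y i - z i) ^ γ i

end

lemma scale_lint {n : ℕ} (f : Rn n → ℝ≥0∞) (hf : Measurable f) {ρ : ℝ} (hρ : 0 < ρ) :
    ∫⁻ x, f x = ENNReal.ofReal (ρ ^ n) * ∫⁻ x, f (ρ • x) := by
  have h := Measure.map_addHaar_smul (volume : Measure (Rn n)) hρ.ne'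
  have h2 : ∫⁻ x, f (ρ • x) = ∫⁻ x, f x ∂(Measure.map (fun x => ρ • x) (volume : Measure (Rn n))) := by
    rw [lintegral_map hf (measurable_const_smul ρ)]
  rw [h2]
  change _ = _ * ∫⁻ x, f x ∂(Measure.map (ρ • ·) (volume : Measure (Rn n)))
  rw [h, lintegral_smul_measure, smul_eq_mul, ← mul_assoc, ← ENNReal.ofReal_mul (by positivity)]
  have : ρ ^ n * |(ρ ^ Module.finrank ℝ (Rn n))⁻¹| = 1 := by
    rw [finrank_euclideanSpace_fin, abs_of_pos (by positivity)]
    field_simp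
  rw [this]; simp

/-- radial integral near zero -/
lemma rad_near {n : ℕ} (hn : 0 < n) {β : ℝ} (hβn : β < n) :
    ∃ C : ℝ≥0∞, C ≠ ⊤ ∧ ∀ ρ : ℝ, 0 < ρ → ∀ v : Rn n,
      ∫⁻ x, (Metric.ball v ρ).indicator (fun x => ENNReal.ofReal (‖x - v‖ ^ (-β))) x
        ≤ C * ENNReal.ofReal (ρ ^ ((n:ℝ) - β)) := by
  have : Nonempty (Fin n) := ⟨⟨0, hn⟩⟩
  have hint : IntegrableOn (fun x : Rn n => ‖x‖ ^ (-β)) (Metric.ball 0 1) := by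
    rw [integrableOn_fun_norm_addHaar volume (f := fun y : ℝ => y ^ (-β))]
    have : IntegrableOn (fun y : ℝ => y ^ ((n:ℝ) - 1 - β)) (Set.Ioo 0 1) := by
      rw [intervalIntegral.integrableOn_Ioo_rpow_iff one_pos]
      linarith
    refine this.congr_fun ?_ measurableSet_Ioo
    intro y hy
    simp only [finrank_euclideanSpace_fin, smul_eq_mul]
    rw [← Real.rpow_natCast, ← Real.rpow_add hy.1, Nat.cast_sub hn]
    congr 1
    simp; ring
  refine ⟨∫⁻ x in Metric.ball (0 : Rn n) 1, ENNReal.ofReal (‖x‖ ^ (-β)), ?_, ?_⟩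
  · have := hint.2
    rw [hasFiniteIntegral_iff_ofReal] at this
    · exact this.ne
    · exact Filter.Eventually.of_forall fun x => by positivity
  intro ρ hρ v
  rw [← lintegral_add_right_eq_self _ v]
  rw [scale_lint _ _ hρ, ← lintegral_indicator measurableSet_ball]
  · rw [mul_comm, ← lintegral_mul_const' _ _ ENNReal.ofReal_ne_top, ← lintegral_mul_const' _ _ ENNReal.ofReal_ne_top]
    refine lintegral_mono fun x => ?_
    by_cases hx : x ∈ Metric.ball (0 : Rn n) 1
    · have hx' : ρ • x + v ∈ Metric.ball v ρ := by
        simp only [Metric.mem_ball, dist_zero_right] at hx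
        simp [dist_eq_norm, norm_smul, abs_of_pos hρ]
        nlinarith
      simp only [Set.indicator_of_mem hx, Set.indicator_of_mem hx', add_sub_cancel_right]
      rw [← ENNReal.ofReal_mul (by positivity), ← ENNReal.ofReal_mul (by positivity)]
      apply ENNReal.ofReal_le_ofReal
      rw [norm_smul, Real.norm_of_nonneg hρ.le, Real.mul_rpow hρ.le (norm_nonneg _), sub_eq_add_neg,
        Real.rpow_add hρ, Real.rpow_natCast]
      apply le_of_eq; ring
    · have hx' : ρ • x + v ∉ Metric.ball v ρ := by
        simp only [Metric.mem_ball, dist_zero_right] at hx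
        simp [dist_eq_norm, norm_smul, abs_of_pos hρ]
        nlinarith
      simp [Set.indicator_of_notMem hx, Set.indicator_of_notMem hx']
  · refine Measurable.comp (g := (Metric.ball v ρ).indicator (fun x => ENNReal.ofReal (‖x - v‖ ^ (-β))))
      (f := fun x => x + v) (Measurable.indicator (by fun_prop) measurableSet_ball) (by fun_prop)

lemma rad_far {n : ℕ} (hn : 0 < n) {t : ℝ} (ht : 0 < t) :
    ∃ C : ℝ≥0∞, C ≠ ⊤ ∧ ∀ ρ : ℝ, 0 < ρ → ∀ v : Rn n,
      ∫⁻ x, (Metric.ball v ρ)ᶜ.indicator (fun x => ENNReal.ofReal (‖x - v‖ ^ (-((n:ℝ) + t)))) x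
        ≤ C * ENNReal.ofReal (ρ ^ (-t)) := by
  have : Nonempty (Fin n) := ⟨⟨0, hn⟩⟩
  have hfin : (∫⁻ x in (Metric.ball (0 : Rn n) 1)ᶜ, ENNReal.ofReal (‖x‖ ^ (-((n:ℝ) + t)))) ≠ ⊤ := by
    have h1 : ∫⁻ x : Rn n, ENNReal.ofReal ((1 + ‖x‖) ^ (-((n:ℝ) + t))) < ⊤ :=
      finite_integral_one_add_norm (by simp [ht])
    have h2 : (∫⁻ x in (Metric.ball (0 : Rn n) 1)ᶜ, ENNReal.ofReal (‖x‖ ^ (-((n:ℝ) + t)))) ≤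
        ENNReal.ofReal (2 ^ ((n:ℝ) + t)) * ∫⁻ x : Rn n, ENNReal.ofReal ((1 + ‖x‖) ^ (-((n:ℝ) + t))) := by
      rw [← lintegral_const_mul' _ _ ENNReal.ofReal_ne_top]
      refine le_trans (setLIntegral_mono' measurableSet_ball.compl fun x hx => ?_) (setLIntegral_le_lintegral _ _)
      rw [← ENNReal.ofReal_mul (by positivity)]
      apply ENNReal.ofReal_le_ofReal
      have hx1 : 1 ≤ ‖x‖ := by simpa using hx
      rw [Real.rpow_neg (by positivity), Real.rpow_neg (by positivity), ← div_eq_mul_inv,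
        ← Real.div_rpow (by positivity) (by positivity), ← Real.inv_rpow (by positivity)]
      apply Real.rpow_le_rpow (by positivity) _ (by positivity)
      rw [inv_eq_one_div, div_le_div_iff₀ (by positivity) (by positivity)]
      linarith
    exact ne_top_of_le_ne_top (ENNReal.mul_ne_top ENNReal.ofReal_ne_top h1.ne) h2
  refine ⟨_, hfin, ?_⟩
  intro ρ hρ v
  rw [← lintegral_add_right_eq_self _ v]
  rw [scale_lint _ _ hρ, ← lintegral_indicator measurableSet_ball.compl]
  · rw [mul_comm, ← lintegral_mul_const' _ _ ENNReal.ofReal_ne_top, ← lintegral_mul_const' _ _ ENNReal.ofReal_ne_top]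
    refine lintegral_mono fun x => ?_
    by_cases hx : x ∈ Metric.ball (0 : Rn n) 1
    · have hx' : ρ • x + v ∈ Metric.ball v ρ := by
        simp only [Metric.mem_ball, dist_zero_right] at hx
        simp [dist_eq_norm, norm_smul, abs_of_pos hρ]
        nlinarith
      rw [Set.indicator_of_notMem (by simpa using hx'), Set.indicator_of_notMem (by simpa using hx)]
      simp
    · have hx' : ρ • x + v ∉ Metric.ball v ρ := by
        simp only [Metric.mem_ball, dist_zero_right] at hx
        simp [dist_eq_norm, norm_smul, abs_of_pos hρ]
        nlinarith
      rw [Set.indicator_of_mem (by exact hx'), Set.indicator_of_mem (by exact hx)]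
      simp only [add_sub_cancel_right]
      rw [← ENNReal.ofReal_mul (by positivity), ← ENNReal.ofReal_mul (by positivity)]
      apply ENNReal.ofReal_le_ofReal
      rw [norm_smul, Real.norm_of_nonneg hρ.le, Real.mul_rpow hρ.le (norm_nonneg _)]
      have : ρ ^ (-t) = ρ ^ (-((n:ℝ)+t)) * ρ ^ n := by
        rw [← Real.rpow_natCast, ← Real.rpow_add hρ]; congr 1; ring
      rw [this]
      apply le_of_eq; ring
  · refine Measurable.comp (g := (Metric.ball v ρ)ᶜ.indicator (fun x => ENNReal.ofReal (‖x - v‖ ^ (-((n:ℝ) + t)))))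
      (f := fun x => x + v) (Measurable.indicator (by fun_prop) measurableSet_ball.compl) (by fun_prop)

lemma pts_bound {n : ℕ} (hn : 0 < n) {ι : Type} [Fintype ι] (i0 : ι) (β : ι → ℝ)
    (hβ0 : ∀ i, 0 < β i) (hβn : ∀ i, β i < n) {t : ℝ} (ht : 0 < t) (hsum : ∑ i, β i = n + t)
    {c D : ℝ} (hc : 0 < c) (hD : 0 < D) :
    ∃ C : ℝ≥0∞, C ≠ ⊤ ∧ ∀ R : ℝ, 0 < R → ∀ v : ι → Rn n,
      (∀ i j, i ≠ j → c * R ≤ ‖v i - v j‖) → (∀ i j, ‖v i - v j‖ ≤ D * R) →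
      ∫⁻ x, ENNReal.ofReal (∏ i, ‖x - v i‖ ^ (-(β i))) ≤ C * ENNReal.ofReal (R ^ (-t)) := by
  classical
  choose Cn hCn hn2 using fun i => rad_near hn (hβn i)
  obtain ⟨Cf, hCf, hf2⟩ := rad_far hn ht
  set κ : ℝ := (1 + 2 * D / c) with hκ
  have hκpos : 0 < κ := by positivity
  refine ⟨∑ i, Cn i * ENNReal.ofReal ((c/2) ^ (-t)) + Cf * ENNReal.ofReal (κ ^ ((n:ℝ) + t) * (c/2)^(-t)), ?_, ?_⟩
  · refine ENNReal.add_ne_top.2 ⟨?_, ENNReal.mul_ne_top hCf ENNReal.ofReal_ne_top⟩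
    exact (ENNReal.sum_lt_top.2 fun i _ => (ENNReal.mul_ne_top (hCn i) ENNReal.ofReal_ne_top).lt_top).ne
  intro R hR v hsep hclose
  set ρ : ℝ := c / 2 * R with hρ
  have hρpos : 0 < ρ := by positivity
  have key : ∀ x, ENNReal.ofReal (∏ i, ‖x - v i‖ ^ (-(β i))) ≤
      ∑ i, ENNReal.ofReal (ρ ^ (β i - (n + t))) *
        (Metric.ball (v i) ρ).indicator (fun x => ENNReal.ofReal (‖x - v i‖ ^ (-(β i)))) x
      + ENNReal.ofReal (κ ^ ((n:ℝ) + t)) *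
        (Metric.ball (v i0) ρ)ᶜ.indicator (fun x => ENNReal.ofReal (‖x - v i0‖ ^ (-((n:ℝ) + t)))) x := by
    intro x
    by_cases h : ∃ i, x ∈ Metric.ball (v i) ρ
    · obtain ⟨i, hi⟩ := h
      refine le_trans ?_ le_self_add
      refine le_trans ?_ (Finset.single_le_sum (fun _ _ => zero_le) (Finset.mem_univ i))
      rw [Set.indicator_of_mem hi, ← ENNReal.ofReal_mul (by positivity)]
      apply ENNReal.ofReal_le_ofReal
      rw [← Finset.mul_prod_erase _ _ (Finset.mem_univ i), mul_comm]
      apply mul_le_mul_of_nonneg_right _ (by positivity)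
      have e : β i - (n + t) = ∑ j ∈ Finset.univ.erase i, (-(β j)) := by
        rw [← hsum, ← Finset.add_sum_erase _ _ (Finset.mem_univ i), Finset.sum_neg_distrib]; ring
      rw [e, Real.rpow_sum_of_pos hρpos]
      apply Finset.prod_le_prod
      · intros; positivity
      intro j hj
      apply Real.rpow_le_rpow_of_nonpos hρpos _ (by linarith [hβ0 j])
      have h1 := hsep i j (Finset.ne_of_mem_erase hj).symm
      have h2 : ‖x - v i‖ < ρ := by simpa [dist_eq_norm] using hi
      have h3 : ‖v i - v j‖ ≤ ‖x - v i‖ + ‖x - v j‖ := by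
        have := norm_sub_le (x - v j) (x - v i)
        rw [show (x - v j) - (x - v i) = v i - v j by abel] at this
        linarith
      linarith
    · push Not at h
      refine le_trans ?_ le_add_self
      rw [Set.indicator_of_mem (by exact h i0), ← ENNReal.ofReal_mul (by positivity)]
      apply ENNReal.ofReal_le_ofReal
      have hge : ∀ j, ρ ≤ ‖x - v j‖ := fun j => by simpa [dist_eq_norm] using h j
      have hcmp : ∀ j, ‖x - v i0‖ / κ ≤ ‖x - v j‖ := by
        intro j
        rw [div_le_iff₀ hκpos]
        have h3 : ‖x - v i0‖ ≤ ‖x - v j‖ + ‖v j - v i0‖ := by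
          simpa using norm_add_le (x - v j) (v j - v i0)
        have h4 := hclose j i0
        have h5 : D * R = 2 * D / c * ρ := by rw [hρ]; field_simp
        have h6 : 2 * D / c * ρ ≤ 2 * D / c * ‖x - v j‖ := by
          apply mul_le_mul_of_nonneg_left (hge j) (by positivity)
        rw [hκ]; nlinarith
      have hx0 : 0 < ‖x - v i0‖ := hρpos.trans_le (hge i0)
      calc ∏ i, ‖x - v i‖ ^ (-(β i)) ≤ ∏ i, (‖x - v i0‖ / κ) ^ (-(β i)) := by
            apply Finset.prod_le_prod
            · intros; positivity
            intro j _
            exact Real.rpow_le_rpow_of_nonpos (by positivity) (hcmp j) (by linarith [hβ0 j])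
        _ = (‖x - v i0‖ / κ) ^ (-((n:ℝ) + t)) := by
            rw [← Real.rpow_sum_of_pos (by positivity), Finset.sum_neg_distrib, hsum]
        _ ≤ _ := by
            rw [Real.div_rpow hx0.le hκpos.le, Real.rpow_neg hκpos.le, div_inv_eq_mul, mul_comm]
  refine (lintegral_mono key).trans ?_
  have hm1 : ∀ i, Measurable ((Metric.ball (v i) ρ).indicator (fun x => ENNReal.ofReal (‖x - v i‖ ^ (-(β i))))) :=
    fun i => Measurable.indicator (by fun_prop) measurableSet_ball
  have hm2 : Measurable ((Metric.ball (v i0) ρ)ᶜ.indicator (fun x => ENNReal.ofReal (‖x - v i0‖ ^ (-((n:ℝ) + t))))) :=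
    Measurable.indicator (by fun_prop) measurableSet_ball.compl
  rw [lintegral_add_right _ (hm2.const_mul _), lintegral_finsetSum _ (fun i _ => (hm1 i).const_mul _),
    lintegral_const_mul _ hm2, add_mul, Finset.sum_mul]
  refine add_le_add (Finset.sum_le_sum fun i _ => ?_) ?_
  · rw [lintegral_const_mul _ (hm1 i)]
    refine (mul_le_mul_right (hn2 i ρ hρpos (v i)) _).trans ?_
    rw [mul_left_comm, mul_assoc, ← ENNReal.ofReal_mul (by positivity), ← ENNReal.ofReal_mul (by positivity),
      ← Real.rpow_add hρpos, ← Real.mul_rpow (by positivity) hR.le]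
    apply le_of_eq; congr 3; ring
  · refine (mul_le_mul_right (hf2 ρ hρpos (v i0)) _).trans ?_
    rw [mul_left_comm, mul_assoc, ← ENNReal.ofReal_mul (by positivity), ← ENNReal.ofReal_mul (by positivity),
      mul_assoc, ← Real.mul_rpow (by positivity) hR.le]

lemma mApp_eq {n : ℕ} (A : Matrix (Fin n) (Fin n) ℝ) (x : Rn n) :
    mApp A x = Matrix.toEuclideanCLM (𝕜 := ℝ) A x := rfl

lemma mApp_le {n : ℕ} (A : Matrix (Fin n) (Fin n) ℝ) (x : Rn n) :
    ‖mApp A x‖ ≤ opNorm A * ‖x‖ := by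
  rw [mApp_eq]; exact ContinuousLinearMap.le_opNorm _ _

lemma mApp_mul {n : ℕ} (A B : Matrix (Fin n) (Fin n) ℝ) (x : Rn n) :
    mApp (A * B) x = mApp A (mApp B x) := by
  simp only [mApp_eq, map_mul]; rfl

lemma mApp_one {n : ℕ} (x : Rn n) : mApp (1 : Matrix (Fin n) (Fin n) ℝ) x = x := by
  simp only [mApp_eq, map_one]; rfl

lemma mApp_sub {n : ℕ} (A B : Matrix (Fin n) (Fin n) ℝ) (x : Rn n) :
    mApp (A - B) x = mApp A x - mApp B x := by
  simp only [mApp_eq, map_sub]; rfl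

lemma mApp_sub' {n : ℕ} (A : Matrix (Fin n) (Fin n) ℝ) (x y : Rn n) :
    mApp A (x - y) = mApp A x - mApp A y := by
  simp only [mApp_eq, map_sub]

lemma mApp_lower {n : ℕ} (A : Matrix (Fin n) (Fin n) ℝ) (hA : IsUnit A) :
    ∃ c > 0, ∀ x : Rn n, c * ‖x‖ ≤ ‖mApp A x‖ := by
  refine ⟨(opNorm A⁻¹ + 1)⁻¹, ?_, fun x => ?_⟩
  · have : 0 ≤ opNorm A⁻¹ := norm_nonneg _
    positivity
  · have h0 : 0 ≤ opNorm A⁻¹ := norm_nonneg _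
    have h : mApp A⁻¹ (mApp A x) = x := by
      rw [← mApp_mul, Matrix.nonsing_inv_mul _ ((Matrix.isUnit_iff_isUnit_det A).1 hA), mApp_one]
    have h2 := mApp_le A⁻¹ (mApp A x)
    rw [h] at h2
    rw [inv_mul_le_iff₀ (by positivity)]
    nlinarith [norm_nonneg (mApp A x)]

lemma fin_inf {ι : Type} [Fintype ι] (P : ι → ℝ → Prop) (hP : ∀ i, ∃ c > 0, P i c)
    (hmono : ∀ i c c', 0 < c' → c' ≤ c → P i c → P i c') : ∃ c > 0, ∀ i, P i c := by
  classical
  choose c hc h using hP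
  obtain ⟨m, hm⟩ : ∃ m > 0, ∀ i, m ≤ c i := by
    by_cases he : Nonempty ι
    · obtain ⟨i, hi⟩ := Finite.exists_min c
      exact ⟨c i, hc i, hi⟩
    · exact ⟨1, one_pos, fun i => (he ⟨i⟩).elim⟩
  exact ⟨m, hm.1, fun i => hmono i _ _ hm.1 (hm.2 i) (h i)⟩

/-- integral in `x` of the weighted kernel -/
lemma kern_int_x {n m : ℕ} (hn : 0 < n) (A : Fin m → Matrix (Fin n) (Fin n) ℝ) (hA : ∀ i, IsUnit (A i))
    (hAij : ∀ i j, i ≠ j → IsUnit (A i - A j)) (β : Fin m → ℝ)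
    (hβ0 : ∀ i, 0 < β i) (hβn : ∀ i, β i < n) (hsum : ∑ i, β i = n) {t : ℝ} (ht : 0 < t) (htn : t < n) :
    ∃ C : ℝ≥0∞, C ≠ ⊤ ∧ ∀ y : Rn n, y ≠ 0 →
      ∫⁻ x, ENNReal.ofReal (kern A β x y * ‖x‖ ^ (-t)) ≤ C * ENNReal.ofReal (‖y‖ ^ (-t)) := by
  classical
  let B : Option (Fin m) → Matrix (Fin n) (Fin n) ℝ := fun o => o.elim 0 A
  have hB : ∀ i j, i ≠ j → IsUnit (B i - B j) := by
    intro i j hij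
    rcases i with _ | i <;> rcases j with _ | j
    · exact absurd rfl hij
    · simpa [B] using (hA j)
    · simpa [B] using (hA i)
    · exact hAij i j (fun h => hij (by rw [h]))
  obtain ⟨c, hc, hc2⟩ : ∃ c > 0, ∀ ij : Option (Fin m) × Option (Fin m),
      ij.1 ≠ ij.2 → ∀ x : Rn n, c * ‖x‖ ≤ ‖mApp (B ij.1 - B ij.2) x‖ := by
    apply fin_inf (fun (ij : Option (Fin m) × Option (Fin m)) c =>
      ij.1 ≠ ij.2 → ∀ x : Rn n, c * ‖x‖ ≤ ‖mApp (B ij.1 - B ij.2) x‖)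
    · rintro ⟨i, j⟩
      by_cases hij : i = j
      · exact ⟨1, one_pos, fun h => absurd hij h⟩
      · obtain ⟨c, h1, h2⟩ := mApp_lower _ (hB i j hij)
        exact ⟨c, h1, fun _ => h2⟩
    · intro ij c c' h0 hcc h hne x
      exact (mul_le_mul_of_nonneg_right hcc (norm_nonneg _)).trans (h hne x)
  set D : ℝ := 1 + ∑ i, ∑ j, opNorm (B i - B j) with hDdef
  have hnn : ∀ i j, 0 ≤ opNorm (B i - B j) := fun i j => norm_nonneg _
  have hD0 : 0 < D := by
    have : 0 ≤ ∑ i, ∑ j, opNorm (B i - B j) := Finset.sum_nonneg fun i _ => Finset.sum_nonneg fun j _ => hnn i j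
    linarith
  have hD : ∀ i j, opNorm (B i - B j) ≤ D := by
    intro i j
    have h1 : opNorm (B i - B j) ≤ ∑ j, opNorm (B i - B j) :=
      Finset.single_le_sum (f := fun j => opNorm (B i - B j)) (fun j _ => hnn i j) (Finset.mem_univ j)
    have h2 : ∑ j, opNorm (B i - B j) ≤ ∑ i, ∑ j, opNorm (B i - B j) :=
      Finset.single_le_sum (f := fun i => ∑ j, opNorm (B i - B j))
        (fun i _ => Finset.sum_nonneg fun j _ => hnn i j) (Finset.mem_univ i)
    linarith
  obtain ⟨C, hC, h⟩ := pts_bound hn (none : Option (Fin m)) (fun o => o.elim t β)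
    (by rintro (_ | i) <;> simp [ht, hβ0]) (by rintro (_ | i) <;> simp [htn, hβn]) ht
    (by rw [Fintype.sum_option]; simp [hsum, add_comm]) hc hD0
  refine ⟨C, hC, fun y hy => ?_⟩
  have := h ‖y‖ (norm_pos_iff.2 hy) (fun o => mApp (B o) y)
    (fun i j hij => by rw [← mApp_sub]; exact hc2 (i, j) hij y)
    (fun i j => by
      rw [← mApp_sub]
      exact (mApp_le _ _).trans (mul_le_mul_of_nonneg_right (hD i j) (norm_nonneg _)))
  refine le_trans (le_of_eq ?_) this
  congr 1; ext x
  rw [Fintype.prod_option, mul_comm]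
  have : mApp (B none) y = 0 := by
    rw [mApp_eq]; simp [B]
  simp only [this, sub_zero, kern, Option.elim]
  rfl

lemma kern_int_y {n m : ℕ} (hn : 0 < n) (A : Fin m → Matrix (Fin n) (Fin n) ℝ) (hA : ∀ i, IsUnit (A i))
    (hAij : ∀ i j, i ≠ j → IsUnit (A i - A j)) (β : Fin m → ℝ)
    (hβ0 : ∀ i, 0 < β i) (hβn : ∀ i, β i < n) (hsum : ∑ i, β i = n) {t : ℝ} (ht : 0 < t) (htn : t < n) :
    ∃ C : ℝ≥0∞, C ≠ ⊤ ∧ ∀ x : Rn n, x ≠ 0 →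
      ∫⁻ y, ENNReal.ofReal (kern A β x y * ‖y‖ ^ (-t)) ≤ C * ENNReal.ofReal (‖x‖ ^ (-t)) := by
  have hdet : ∀ i, IsUnit (A i).det := fun i => (Matrix.isUnit_iff_isUnit_det _).1 (hA i)
  have hinv : ∀ i, IsUnit (A i)⁻¹ := fun i => Matrix.isUnit_nonsing_inv_iff.2 (hA i)
  obtain ⟨C, hC, h⟩ := kern_int_x hn (fun i => (A i)⁻¹) hinv (by
    intro i j hij
    have : (A i)⁻¹ - (A j)⁻¹ = (A i)⁻¹ * (A j - A i) * (A j)⁻¹ := by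
      rw [mul_sub, sub_mul, Matrix.nonsing_inv_mul _ (hdet i), mul_assoc, Matrix.mul_nonsing_inv _ (hdet j)]
      simp
    rw [this]
    exact ((hinv i).mul (hAij j i hij.symm)).mul (hinv j)) β hβ0 hβn hsum ht htn
  choose c hc hc2 using fun i => mApp_lower (A i) (hA i)
  refine ⟨ENNReal.ofReal (∏ i, (c i) ^ (-(β i))) * C, ENNReal.mul_ne_top ENNReal.ofReal_ne_top hC, fun x hx => ?_⟩
  rw [mul_assoc]
  refine le_trans ?_ (mul_le_mul_right (h x hx) _)
  rw [← lintegral_const_mul' _ _ ENNReal.ofReal_ne_top]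
  refine lintegral_mono fun y => ?_
  have hpos : 0 ≤ ∏ i, (c i) ^ (-(β i)) := Finset.prod_nonneg fun i _ => Real.rpow_nonneg (hc i).le _
  rw [← ENNReal.ofReal_mul hpos]
  apply ENNReal.ofReal_le_ofReal
  rw [← mul_assoc]
  apply mul_le_mul_of_nonneg_right _ (by positivity)
  simp only [kern]
  rw [← Finset.prod_mul_distrib]
  apply Finset.prod_le_prod
  · intros; positivity
  intro i _
  rw [← Real.mul_rpow (hc i).le (norm_nonneg _)]
  have e : x - mApp (A i) y = - mApp (A i) (y - mApp (A i)⁻¹ x) := by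
    rw [mApp_sub', ← mApp_mul, Matrix.mul_nonsing_inv _ (hdet i), mApp_one]; simp
  rw [e, norm_neg]
  by_cases h0 : y - mApp (A i)⁻¹ x = 0
  · rw [h0]; simp [mApp_eq]
  · exact Real.rpow_le_rpow_of_nonpos (mul_pos (hc i) (norm_pos_iff.2 h0)) (hc2 i _) (by linarith [hβ0 i])

lemma schur {X Y : Type} [MeasurableSpace X] [MeasurableSpace Y] {μ : Measure X} {ν : Measure Y}
    [SFinite μ] [SFinite ν] (G : X → Y → ℝ≥0∞) (hG : Measurable (Function.uncurry G))
    (w : X → ℝ≥0∞) (hw : Measurable w) (u : Y → ℝ≥0∞) (hu : Measurable u)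
    (hu0 : ∀ᵐ y ∂ν, u y ≠ 0 ∧ u y ≠ ⊤)
    {a b c t τ : ℝ} (ha : 0 < a) (hb : 0 < b) (hc : 0 ≤ c) (habc : a + b + c = 1) (hτ : τ * a = t * b)
    {C₁ C₂ : ℝ≥0∞} (hC1 : C₁ ≠ ⊤)
    (h1 : ∀ᵐ x ∂μ, ∫⁻ y, G x y * u y ^ (-t) ∂ν ≤ C₁ * w x ^ (-t))
    (h2 : ∀ᵐ y ∂ν, ∫⁻ x, G x y * w x ^ (-τ) ∂μ ≤ C₂ * u y ^ (-τ))
    (F : Y → ℝ≥0∞) (hF : Measurable F) (hFfin : ∫⁻ y, F y ∂ν ≠ ⊤) :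
    ∫⁻ x, (∫⁻ y, G x y ^ (a + b) * F y ^ (a + c) ∂ν) ^ (1 / a) ∂μ ≤
      C₁ ^ (b / a) * C₂ * (∫⁻ y, F y ∂ν) ^ ((a + c) / a) := by
  have hGx : ∀ x, Measurable (G x) := fun x => hG.comp measurable_prodMk_left
  have hGy : ∀ y, Measurable (fun x => G x y) := fun y => hG.comp measurable_prodMk_right
  have hG1 : Measurable (fun z : X × Y => G z.1 z.2) := hG
  set S := ∫⁻ y, F y ∂ν with hS
  have step1 : ∀ᵐ x ∂μ, (∫⁻ y, G x y ^ (a + b) * F y ^ (a + c) ∂ν) ^ (1 / a) ≤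
      (C₁ ^ (b / a) * S ^ (c / a)) * ∫⁻ y, G x y * F y * u y ^ τ * w x ^ (-τ) ∂ν := by
    filter_upwards [h1] with x hx
    have e1 : ∫⁻ y, G x y ^ (a + b) * F y ^ (a + c) ∂ν ≤
        (∫⁻ y, G x y * F y * u y ^ τ ∂ν) ^ a * (∫⁻ y, G x y * u y ^ (-t) ∂ν) ^ b * S ^ c := by
      have := ENNReal.lintegral_prod_norm_pow_le (μ := ν) (Finset.univ : Finset (Fin 3))
        (f := ![fun y => G x y * F y * u y ^ τ, fun y => G x y * u y ^ (-t), F])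
        (p := ![a, b, c]) (by
          intro i _
          have := hGx x
          fin_cases i <;> simp <;> fun_prop) (by simp [Fin.sum_univ_three, habc])
        (by intro i _; fin_cases i <;> simp [ha.le, hb.le, hc])
      simp only [Fin.prod_univ_three] at this
      refine le_trans (le_of_eq ?_) this
      apply lintegral_congr_ae
      filter_upwards [hu0] with y hy
      simp only [Matrix.cons_val_zero, Matrix.cons_val_one, Matrix.cons_val]
      rw [ENNReal.mul_rpow_of_nonneg _ _ ha.le, ENNReal.mul_rpow_of_nonneg _ _ ha.le,
        ENNReal.mul_rpow_of_nonneg _ _ hb.le, ← ENNReal.rpow_mul, ← ENNReal.rpow_mul,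
        ENNReal.rpow_add_of_nonneg _ _ ha.le hb.le, ENNReal.rpow_add_of_nonneg _ _ ha.le hc, hτ]
      have : u y ^ (t * b) * u y ^ (-t * b) = 1 := by
        rw [← ENNReal.rpow_add _ _ hy.1 hy.2]; simp
      calc _ = G x y ^ a * G x y ^ b * (F y ^ a * F y ^ c) * 1 := by ring
        _ = _ := by rw [← this]; ring
    have e2 : (∫⁻ y, G x y ^ (a + b) * F y ^ (a + c) ∂ν) ^ (1 / a) ≤
        ((∫⁻ y, G x y * F y * u y ^ τ ∂ν) ^ a * (C₁ * w x ^ (-t)) ^ b * S ^ c) ^ (1/a) := by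
      apply ENNReal.rpow_le_rpow _ (by positivity)
      refine e1.trans ?_
      gcongr
    refine e2.trans (le_of_eq ?_)
    rw [lintegral_mul_const _ (by have := hGx x; fun_prop)]
    rw [ENNReal.mul_rpow_of_nonneg _ _ (by positivity), ENNReal.mul_rpow_of_nonneg _ _ (by positivity),
      ENNReal.mul_rpow_of_nonneg _ _ hb.le, ENNReal.mul_rpow_of_nonneg _ _ (by positivity),
      ← ENNReal.rpow_mul, ← ENNReal.rpow_mul, ← ENNReal.rpow_mul, ← ENNReal.rpow_mul, ← ENNReal.rpow_mul]
    have q1 : a * (1 / a) = 1 := by field_simp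
    have q2 : -t * b * (1 / a) = -τ := by
      rw [neg_mul, ← hτ]; field_simp
    have q3 : -t * (b * (1 / a)) = -τ := by rw [← q2]; ring
    simp only [q1, q2, q3, ENNReal.rpow_one]
    simp only [mul_one_div]
    ring
  refine (lintegral_mono_ae step1).trans ?_
  rw [lintegral_const_mul' _ _ (ENNReal.mul_ne_top (ENNReal.rpow_ne_top_of_nonneg (by positivity) hC1)
    (ENNReal.rpow_ne_top_of_nonneg (by positivity) hFfin))]
  have step2 : ∫⁻ x, ∫⁻ y, G x y * F y * u y ^ τ * w x ^ (-τ) ∂ν ∂μ ≤ C₂ * S := by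
    rw [lintegral_lintegral_swap (by
      apply Measurable.aemeasurable
      simp only [Function.uncurry_def]; fun_prop)]
    rw [hS, ← lintegral_const_mul _ hF]
    apply lintegral_mono_ae
    filter_upwards [h2, hu0] with y hy hy0
    have : ∫⁻ x, G x y * F y * u y ^ τ * w x ^ (-τ) ∂μ = (F y * u y ^ τ) * ∫⁻ x, G x y * w x ^ (-τ) ∂μ := by
      rw [← lintegral_const_mul _ (by have := hGy y; fun_prop)]
      congr 1; ext x; ring
    rw [this]
    calc _ ≤ (F y * u y ^ τ) * (C₂ * u y ^ (-τ)) := by gcongr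
      _ = C₂ * F y * (u y ^ τ * u y ^ (-τ)) := by ring
      _ = C₂ * F y := by rw [← ENNReal.rpow_add _ _ hy0.1 hy0.2]; simp
  refine (mul_le_mul_right step2 _).trans (le_of_eq ?_)
  have : (a + c) / a = 1 + c / a := by field_simp
  rw [this, ENNReal.rpow_add_of_nonneg _ _ zero_le_one (by positivity), ENNReal.rpow_one]
  ring

lemma measurable_kern {n m : ℕ} (A : Fin m → Matrix (Fin n) (Fin n) ℝ) (β : Fin m → ℝ) :
    Measurable (fun z : Rn n × Rn n => kern A β z.1 z.2) := by
  simp only [kern, mApp_eq]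
  fun_prop

lemma kern_pow {n m : ℕ} (A : Fin m → Matrix (Fin n) (Fin n) ℝ) (β αe : Fin m → ℝ) (s : ℝ)
    (h : ∀ i, β i * s = αe i) (x y : Rn n) : kern A β x y ^ s = kern A αe x y := by
  simp only [kern]
  rw [← Real.finsetProd_rpow _ _ (by intros; positivity)]
  refine Finset.prod_congr rfl fun i _ => ?_
  rw [← Real.rpow_mul (norm_nonneg _), neg_mul, h]

lemma kern_nonneg {n m : ℕ} (A : Fin m → Matrix (Fin n) (Fin n) ℝ) (β : Fin m → ℝ) (x y : Rn n) :
    0 ≤ kern A β x y := Finset.prod_nonneg fun _ _ => by positivity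

lemma HLS {n m : ℕ} (hn : 0 < n) (hm : 1 < m)
    (A : Fin m → Matrix (Fin n) (Fin n) ℝ) (hA : ∀ i, IsUnit (A i))
    (hAij : ∀ i j, i ≠ j → IsUnit (A i - A j))
    (α : ℝ) (hα0 : 0 ≤ α) (hαn : α < n)
    (αe : Fin m → ℝ) (hαe : ∀ i, 0 < αe i) (hsum : ∑ i, αe i = (n : ℝ) - α)
    (p₀ q₀ : ℝ) (hp₀1 : 1 < p₀) (hq0 : 0 < q₀)
    (hq₀ : 1 / q₀ = 1 / p₀ - α / n) :
    ∃ C : ℝ≥0∞, C ≠ ⊤ ∧ ∀ f : Rn n → ℝ, Measurable f → eLpNorm f (ENNReal.ofReal p₀) volume ≠ ⊤ →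
      eLpNorm (Tα A αe f) (ENNReal.ofReal q₀) volume ≤ C * eLpNorm f (ENNReal.ofReal p₀) volume := by
  have hne : Nonempty (Fin n) := ⟨⟨0, hn⟩⟩
  have hnR : (0:ℝ) < n := by exact_mod_cast hn
  have hp0 : 0 < p₀ := by linarith
  set a := 1 / q₀ with haDef
  set b := 1 - 1 / p₀ with hbDef
  set c := α / (n:ℝ) with hcDef
  have ha : 0 < a := by positivity
  have hb : 0 < b := by
    rw [hbDef, sub_pos, div_lt_one hp0]; exact hp₀1
  have hc : 0 ≤ c := by positivity
  have hab : a + b = 1 - α / n := by rw [hq₀]; ring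
  have hac : a + c = 1 / p₀ := by rw [hq₀]; ring
  set s : ℝ := a + b with hs
  have hspos : 0 < s := by positivity
  have hsn : s * n = n - α := by rw [hab]; field_simp
  let β : Fin m → ℝ := fun i => αe i / s
  have hβs : ∀ i, β i * s = αe i := fun i => by simp only [β]; field_simp
  have hβ0 : ∀ i, 0 < β i := fun i => div_pos (hαe i) hspos
  have hβsum : ∑ i, β i = n := by
    simp only [β]
    rw [← Finset.sum_div, hsum, ← hsn]; field_simp
  have hβn : ∀ i, β i < n := by
    intro i
    obtain ⟨j, hj⟩ : ∃ j : Fin m, j ≠ i := by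
      have : Nontrivial (Fin m) := Fin.nontrivial_iff_two_le.2 hm
      exact exists_ne i
    rw [← hβsum]
    exact Finset.single_lt_sum hj (Finset.mem_univ i) (Finset.mem_univ j) (hβ0 j)
      (fun k _ _ => (hβ0 k).le)
  obtain ⟨t, ht, htn, hτn⟩ : ∃ t : ℝ, 0 < t ∧ t < n ∧ t * b / a < n := by
    refine ⟨min (n / 2) (n / 2 * (a / b)), by positivity, ?_, ?_⟩
    · exact (min_le_left _ _).trans_lt (by linarith)
    · have : min ((n:ℝ) / 2) (n / 2 * (a / b)) * b / a ≤ (n / 2 * (a / b)) * b / a := by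
        gcongr; exact min_le_right _ _
      have e : ((n:ℝ) / 2 * (a / b)) * b / a = n / 2 := by field_simp
      linarith
  obtain ⟨C1, hC1, h1⟩ := kern_int_y hn A hA hAij β hβ0 hβn hβsum ht htn
  obtain ⟨C2, hC2, h2⟩ := kern_int_x hn A hA hAij β hβ0 hβn hβsum (t := t * b / a) (by positivity) hτn
  have hz : ∀ᵐ y : Rn n, y ≠ 0 := by
    rw [ae_iff]; simp
  refine ⟨(C1 ^ (b / a) * C2) ^ a, ENNReal.rpow_ne_top_of_nonneg ha.le
    (ENNReal.mul_ne_top (ENNReal.rpow_ne_top_of_nonneg (by positivity) hC1) hC2), fun f hf hfin => ?_⟩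
  have hE : ∀ (g : Rn n → ℝ) (e : ℝ), 0 < e → eLpNorm g (ENNReal.ofReal e) volume = (∫⁻ x, ‖g x‖ₑ ^ e) ^ (1 / e) := by
    intro g e he
    rw [eLpNorm_eq_lintegral_rpow_enorm_toReal (by simpa using he) (by simp), ENNReal.toReal_ofReal he.le]
  rw [hE _ _ hp0] at hfin ⊢
  rw [hE _ _ hq0]
  have hS : ∫⁻ x, ‖f x‖ₑ ^ p₀ ≠ ⊤ := by
    intro h; rw [h] at hfin
    exact hfin (ENNReal.top_rpow_of_pos (by positivity))
  have := schur (μ := (volume : Measure (Rn n))) (ν := (volume : Measure (Rn n)))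
    (fun x y => ENNReal.ofReal (kern A β x y)) (measurable_kern A β).ennreal_ofReal
    (fun x => ENNReal.ofReal ‖x‖) (by fun_prop) (fun x => ENNReal.ofReal ‖x‖) (by fun_prop)
    (by filter_upwards [hz] with y hy; simpa using hy) ha hb hc (by linarith [hab])
    (t := t) (τ := t * b / a) (by field_simp) (C₁ := C1) (C₂ := C2) hC1
    (by
      filter_upwards [hz] with x hx
      refine le_trans (lintegral_mono_ae ?_) ((h1 x hx).trans ?_)
      · filter_upwards [hz] with y hy
        rw [ENNReal.ofReal_rpow_of_pos (norm_pos_iff.2 hy), ← ENNReal.ofReal_mul (kern_nonneg _ _ _ _)]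
      · rw [ENNReal.ofReal_rpow_of_pos (norm_pos_iff.2 hx)])
    (by
      filter_upwards [hz] with x hx
      refine le_trans (lintegral_mono_ae ?_) ((h2 x hx).trans ?_)
      · filter_upwards [hz] with y hy
        rw [ENNReal.ofReal_rpow_of_pos (norm_pos_iff.2 hy), ← ENNReal.ofReal_mul (kern_nonneg _ _ _ _)]
      · rw [ENNReal.ofReal_rpow_of_pos (norm_pos_iff.2 hx)])
    (fun y => ‖f y‖ₑ ^ p₀) (by fun_prop) hS
  have hpt : ∀ x, ‖Tα A αe f x‖ₑ ≤ ∫⁻ y, ENNReal.ofReal (kern A β x y) ^ (a + b) * (‖f y‖ₑ ^ p₀) ^ (a + c) := by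
    intro x
    refine (enorm_integral_le_lintegral_enorm _).trans (lintegral_mono fun y => ?_)
    rw [hac, ← ENNReal.rpow_mul, mul_one_div_cancel hp0.ne', ENNReal.rpow_one, enorm_mul,
      Real.enorm_of_nonneg (kern_nonneg _ _ _ _), ENNReal.ofReal_rpow_of_nonneg (kern_nonneg _ _ _ _) hspos.le,
      kern_pow A β αe _ hβs]
  calc (∫⁻ x, ‖Tα A αe f x‖ₑ ^ q₀) ^ a ≤
      (∫⁻ x, (∫⁻ y, ENNReal.ofReal (kern A β x y) ^ (a + b) * (‖f y‖ₑ ^ p₀) ^ (a + c)) ^ (1 / a)) ^ a := by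
        gcongr with x
        rw [haDef, one_div_one_div]
        gcongr
        exact hpt x
    _ ≤ _ := ENNReal.rpow_le_rpow this ha.le
    _ = _ := by
      rw [ENNReal.mul_rpow_of_nonneg _ _ ha.le, ← ENNReal.rpow_mul, ← hac]
      congr 2; field_simp

lemma cube_eq {n : ℕ} (z : Rn n) (r : ℝ) :
    cube z r = (WithLp.ofLp : Rn n → (Fin n → ℝ)) ⁻¹' (Set.Icc (fun i => z i - r / 2) (fun i => z i + r / 2)) := by
  ext x
  simp only [cube, Set.mem_ofPred_eq, Set.mem_preimage, Set.mem_Icc, Pi.le_def, abs_le, ← forall_and]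
  refine forall_congr' fun i => ?_
  constructor <;> rintro ⟨h1, h2⟩ <;> constructor <;> linarith

lemma cube_meas {n : ℕ} (z : Rn n) (r : ℝ) : MeasurableSet (cube z r) := by
  rw [cube_eq]
  exact (PiLp.volume_preserving_ofLp (Fin n)).measurable measurableSet_Icc

lemma cube_vol {n : ℕ} (z : Rn n) {r : ℝ} (hr : 0 ≤ r) : volume (cube z r) = ENNReal.ofReal (r ^ n) := by
  rw [cube_eq, (PiLp.volume_preserving_ofLp (Fin n)).measure_preimage measurableSet_Icc.nullMeasurableSet,
    Real.volume_Icc_pi]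
  have : ∀ i, z i + r / 2 - (z i - r / 2) = r := fun i => by ring
  simp only [this, Finset.prod_const, Finset.card_univ, Fintype.card_fin]
  rw [ENNReal.ofReal_pow hr]

lemma cube_norm {n : ℕ} (hn : 0 < n) {z x : Rn n} {r : ℝ} (hr : 0 ≤ r) (hx : x ∈ cube z r) : ‖x - z‖ ≤ n * r := by
  have hn1 : (1:ℝ) ≤ n := by exact_mod_cast hn
  rw [EuclideanSpace.norm_eq]
  apply Real.sqrt_le_iff.2 ⟨by positivity, ?_⟩
  calc ∑ i, ‖(x - z) i‖ ^ 2 ≤ ∑ i : Fin n, r ^ 2 := by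
        apply Finset.sum_le_sum
        intro i _
        have := hx i
        simp only [PiLp.sub_apply, Real.norm_eq_abs]
        apply pow_le_pow_left₀ (abs_nonneg _); linarith
    _ = n * r ^ 2 := by simp
    _ ≤ _ := by nlinarith [sq_nonneg r, mul_nonneg (sq_nonneg r) (by linarith : (0:ℝ) ≤ n - 1)]

lemma modular_eq {n : ℕ} (s : Rn n → ℝ) (hs : ∀ x, 0 < s x) (z : Rn n) (r : ℝ) {l : ℝ} (hl : 0 < l) :
    ∫⁻ x, (ENNReal.ofReal |cubeInd z r x| / ENNReal.ofReal l) ^ (s x) =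
      ∫⁻ x in cube z r, ENNReal.ofReal (l ^ (-(s x))) := by
  rw [← lintegral_indicator (cube_meas z r)]
  congr 1; ext x
  by_cases hx : x ∈ cube z r
  · simp only [cubeInd, Set.indicator_of_mem hx, Pi.one_apply, abs_one]
    rw [← ENNReal.ofReal_div_of_pos hl, ENNReal.ofReal_rpow_of_pos (by positivity), Real.rpow_neg hl.le, one_div,
      Real.inv_rpow hl.le]
  · simp [cubeInd, Set.indicator_of_notMem hx, hs x]

lemma osc {n : ℕ} (hn : 0 < n) (p : Rn n → ℝ) (hp : LogHolderLocal p) {pm : ℝ} (hpm : 0 < pm)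
    (hpmle : ∀ x, pm ≤ p x) {L : ℝ} (hL : 0 < L) :
    ∃ K : ℝ, 0 ≤ K ∧ ∀ (z : Rn n) (r : ℝ), 0 < r → r ≤ 1 → ∀ x ∈ cube z (L * r),
      |1 / p x - 1 / p z| * (-Real.log r) ≤ K := by
  obtain ⟨c, hc, hlh⟩ := hp
  set E : ℝ := max 3 (n * L) with hE
  have hE3 : 3 ≤ E := le_max_left _ _
  have hlE : 0 ≤ Real.log E := Real.log_nonneg (by linarith)
  have hpos : ∀ x, 0 < p x := fun x => hpm.trans_le (hpmle x)
  refine ⟨2 * c / pm ^ 2 + 2 * Real.log E / pm, by positivity, fun z r hr hr1 x hx => ?_⟩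
  have hlr : 0 ≤ - Real.log r := by linarith [Real.log_nonpos hr.le hr1]
  have hnorm : ‖x - z‖ ≤ E * r := by
    refine (cube_norm hn (by positivity) hx).trans ?_
    rw [← mul_assoc]
    exact mul_le_mul_of_nonneg_right (le_max_right _ _) hr.le
  have t1 : 0 ≤ 2 * c / pm ^ 2 := by positivity
  have t2 : 0 ≤ 2 * Real.log E / pm := by positivity
  by_cases h0 : x = z
  · subst h0; simp; positivity
  have hxz : 0 < ‖x - z‖ := norm_pos_iff.2 (sub_ne_zero.2 h0)
  by_cases hcase : Real.log r < -2 * Real.log E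
  · have hlog : Real.log ‖x - z‖ ≤ Real.log E + Real.log r := by
      rw [← Real.log_mul (by linarith) hr.ne']
      exact Real.log_le_log hxz hnorm
    have hlt : ‖x - z‖ < 1 / 2 := by
      have h1 : Real.log ‖x - z‖ < Real.log (E⁻¹) := by rw [Real.log_inv]; linarith
      have h2 := (Real.log_lt_log_iff hxz (by positivity)).1 h1
      have h3 : E⁻¹ ≤ 3⁻¹ := inv_anti₀ (by norm_num) hE3
      linarith [show (3:ℝ)⁻¹ < 1/2 by norm_num]
    have h4 := hlh x z hlt
    have h5 : -Real.log r / 2 ≤ -Real.log ‖x - z‖ := by linarith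
    have h6 : 0 < -Real.log r := by linarith
    have h7 : |p x - p z| * (-Real.log r) ≤ 2 * c := by
      have : |p x - p z| ≤ c / (-Real.log r / 2) := h4.trans (by gcongr)
      rw [le_div_iff₀ (by positivity)] at this
      linarith
    have h8 : |1 / p x - 1 / p z| ≤ |p x - p z| / pm ^ 2 := by
      have : 1 / p x - 1 / p z = (p z - p x) / (p x * p z) := by
        have := hpos x; have := hpos z; field_simp
      rw [this, abs_div, abs_sub_comm, abs_of_pos (mul_pos (hpos x) (hpos z))]
      gcongr
      nlinarith [hpmle x, hpmle z]
    calc _ ≤ |p x - p z| / pm ^ 2 * (-Real.log r) := by gcongr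
      _ = (|p x - p z| * (-Real.log r)) / pm ^ 2 := by ring
      _ ≤ 2 * c / pm ^ 2 := by gcongr
      _ ≤ _ := by linarith
  · push Not at hcase
    have h8 : |1 / p x - 1 / p z| ≤ 1 / pm := by
      have a1 : 1 / p x ≤ 1 / pm := one_div_le_one_div_of_le hpm (hpmle x)
      have a2 : 1 / p z ≤ 1 / pm := one_div_le_one_div_of_le hpm (hpmle z)
      have a3 := one_div_pos.2 (hpos x)
      have a4 := one_div_pos.2 (hpos z)
      rw [abs_le]; constructor <;> linarith
    calc _ ≤ 1 / pm * (2 * Real.log E) := by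
          apply mul_le_mul h8 (by linarith) hlr (by positivity)
      _ = 2 * Real.log E / pm := by ring
      _ ≤ _ := by linarith

lemma low_small {n : ℕ} (p : Rn n → ℝ) {pm : ℝ} (hpm : 0 < pm) (hpmle : ∀ x, pm ≤ p x)
    {K : ℝ} {z : Rn n} {r l : ℝ} (hr : 0 < r)
    (hosc : ∀ x ∈ cube z r, |1 / p x - 1 / p z| * (-Real.log r) ≤ K) (hr1 : r ≤ 1) (hl : 0 < l)
    (hint : ∫⁻ x in cube z r, ENNReal.ofReal (l ^ (-(p x))) ≤ 1) :
    1 / 2 * Real.exp (-(n * K)) * r ^ (n / p z) ≤ l := by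
  by_contra! hlt
  have hlr : 0 ≤ - Real.log r := by linarith [Real.log_nonpos hr.le hr1]
  have key : ∀ x ∈ cube z r, 2 ^ pm * (r ^ n)⁻¹ ≤ l ^ (-(p x)) := by
    intro x hx
    have hpx : 0 < p x := hpm.trans_le (hpmle x)
    have h1 : Real.exp (-(n * K)) * r ^ (n / p z) ≤ r ^ (n / p x) := by
      rw [Real.rpow_def_of_pos hr, Real.rpow_def_of_pos hr, ← Real.exp_add]
      apply Real.exp_le_exp.2
      have h2 : (1 / p x - 1 / p z) * (-Real.log r) ≤ K :=
        (mul_le_mul_of_nonneg_right (le_abs_self _) hlr).trans (hosc x hx)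
      have h3 := mul_le_mul_of_nonneg_left h2 (Nat.cast_nonneg (α := ℝ) n)
      have e : (n:ℝ) * ((1 / p x - 1 / p z) * (-Real.log r)) =
        Real.log r * (n / p z) - Real.log r * (n / p x) := by ring
      linarith
    have h4 : l ≤ r ^ (n / p x) / 2 := by linarith
    have h5 := Real.rpow_le_rpow_of_nonpos hl h4 (by linarith : -(p x) ≤ 0)
    refine le_trans ?_ h5
    rw [Real.div_rpow (by positivity) (by norm_num), ← Real.rpow_mul hr.le, Real.rpow_neg (by norm_num) (p x),
      div_inv_eq_mul, mul_comm]
    have e : (n:ℝ) / p x * -(p x) = -n := by field_simp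
    rw [e, Real.rpow_neg hr.le, Real.rpow_natCast]
    gcongr
    · norm_num
    · exact hpmle x
  have h6 : ∫⁻ x in cube z r, ENNReal.ofReal (2 ^ pm * (r ^ n)⁻¹) ≤ 1 :=
    (setLIntegral_mono' (cube_meas z r) fun x hx => ENNReal.ofReal_le_ofReal (key x hx)).trans hint
  rw [setLIntegral_const, cube_vol z hr.le, ← ENNReal.ofReal_mul (by positivity)] at h6
  have h7 : (2:ℝ) ^ pm * (r ^ n)⁻¹ * r ^ n = 2 ^ pm := by field_simp
  rw [h7, ENNReal.ofReal_le_one] at h6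
  have := Real.one_lt_rpow (by norm_num : (1:ℝ) < 2) hpm
  linarith

lemma up_small {n : ℕ} (q : Rn n → ℝ) {qm : ℝ} (hqm : 0 < qm) (hqmle : ∀ x, qm ≤ q x)
    {K L : ℝ} (hL : 0 < L) : ∃ κ : ℝ, 0 < κ ∧ ∀ (z : Rn n) (r l : ℝ), 0 < r →
    (∀ x ∈ cube z (L * r), |1 / q x - 1 / q z| * (-Real.log r) ≤ K) → r ≤ 1 →
    κ * r ^ (n / q z) ≤ l →
    ∫⁻ x in cube z (L * r), ENNReal.ofReal (l ^ (-(q x))) ≤ 1 := by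
  set B : ℝ := max 1 (L ^ n) with hB
  have hB1 : 1 ≤ B := le_max_left _ _
  set θ : ℝ := B ^ (1 / qm) with hθ
  have hθ1 : 1 ≤ θ := Real.one_le_rpow hB1 (by positivity)
  have hθ2 : θ ^ qm = B := by
    rw [hθ, ← Real.rpow_mul (by linarith)]; field_simp; simp
  refine ⟨θ * Real.exp (n * K), by positivity, ?_⟩
  intro z r l hr hosc hr1 hle
  have hlr : 0 ≤ - Real.log r := by linarith [Real.log_nonpos hr.le hr1]
  have key : ∀ x ∈ cube z (L * r), l ^ (-(q x)) ≤ B⁻¹ * (r ^ n)⁻¹ := by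
    intro x hx
    have hqx : 0 < q x := hqm.trans_le (hqmle x)
    have h1 : r ^ (n / q x) ≤ Real.exp (n * K) * r ^ (n / q z) := by
      rw [Real.rpow_def_of_pos hr, Real.rpow_def_of_pos hr, ← Real.exp_add]
      apply Real.exp_le_exp.2
      have h2 : -(1 / q x - 1 / q z) * (-Real.log r) ≤ K :=
        (mul_le_mul_of_nonneg_right (neg_le_abs _) hlr).trans (hosc x hx)
      have h3 := mul_le_mul_of_nonneg_left h2 (Nat.cast_nonneg (α := ℝ) n)
      have e : (n:ℝ) * (-(1 / q x - 1 / q z) * (-Real.log r)) =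
        -Real.log r * (n / q z) + Real.log r * (n / q x) := by ring
      linarith
    have h4 : θ * r ^ (n / q x) ≤ l := by
      refine le_trans ?_ hle
      rw [mul_assoc]
      exact mul_le_mul_of_nonneg_left h1 (by linarith)
    have h5 := Real.rpow_le_rpow_of_nonpos (by positivity) h4 (by linarith : -(q x) ≤ 0)
    refine h5.trans ?_
    rw [Real.mul_rpow (by positivity) (by positivity), ← Real.rpow_mul hr.le]
    have e : (n:ℝ) / q x * -(q x) = -n := by field_simp
    rw [e, Real.rpow_neg hr.le, Real.rpow_natCast, ← hθ2, ← Real.rpow_neg (by linarith)]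
    apply mul_le_mul_of_nonneg_right _ (by positivity)
    exact Real.rpow_le_rpow_of_exponent_le hθ1 (by linarith [hqmle x])
  refine (setLIntegral_mono' (cube_meas z _) fun x hx => ENNReal.ofReal_le_ofReal (key x hx)).trans ?_
  rw [setLIntegral_const, cube_vol z (by positivity), ← ENNReal.ofReal_mul (by positivity), ENNReal.ofReal_le_one]
  have : B⁻¹ * (r ^ n)⁻¹ * (L * r) ^ n = L ^ n / B := by rw [mul_pow]; field_simp
  rw [this, div_le_one (by positivity)]
  exact le_max_right _ _

lemma tinf {t e1 e2 em M K E : ℝ} (ht : 0 < t) (ht1 : t ≤ 1) (hM : 0 < M) (hE : 1 ≤ E)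
    (hem : 0 ≤ em) (he1 : em ≤ e1) (hK : |e1 - e2| * Real.log E ≤ K) :
    t ^ e1 ≤ Real.exp (M * K) * t ^ e2 + E ^ (-(M * em)) := by
  have hE0 : 0 < E := by linarith
  have hlE : 0 ≤ Real.log E := Real.log_nonneg hE
  have hlt : Real.log t ≤ 0 := Real.log_nonpos ht.le ht1
  by_cases h : -(M * Real.log E) ≤ Real.log t
  · have : t ^ e1 ≤ Real.exp (M * K) * t ^ e2 := by
      rw [Real.rpow_def_of_pos ht, Real.rpow_def_of_pos ht, ← Real.exp_add]
      apply Real.exp_le_exp.2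
      have h1 : (e2 - e1) * (-Real.log t) ≤ |e1 - e2| * (-Real.log t) := by
        apply mul_le_mul_of_nonneg_right _ (by linarith)
        rw [abs_sub_comm]; exact le_abs_self _
      have h2 : |e1 - e2| * (-Real.log t) ≤ |e1 - e2| * (M * Real.log E) :=
        mul_le_mul_of_nonneg_left (by linarith) (abs_nonneg _)
      have h3 := mul_le_mul_of_nonneg_left hK hM.le
      nlinarith
    have h2 : 0 ≤ E ^ (-(M * em)) := by positivity
    linarith
  · push Not at h
    have : t ^ e1 ≤ E ^ (-(M * em)) := by
      have h0 : t ^ e1 ≤ t ^ em := Real.rpow_le_rpow_of_exponent_ge ht ht1 he1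
      refine h0.trans ?_
      rw [Real.rpow_def_of_pos ht, Real.rpow_def_of_pos hE0]
      apply Real.exp_le_exp.2
      nlinarith
    have h2 : 0 ≤ Real.exp (M * K) * t ^ e2 := by positivity
    linarith

lemma tail_int {n : ℕ} {N : ℝ} (hN : (n:ℝ) < N) :
    ∃ B : ℝ, 0 ≤ B ∧ ∫⁻ x : Rn n, ENNReal.ofReal ((Real.exp 1 + ‖x‖) ^ (-N)) ≤ ENNReal.ofReal B := by
  have h1 : ∫⁻ x : Rn n, ENNReal.ofReal ((1 + ‖x‖) ^ (-N)) < ⊤ :=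
    finite_integral_one_add_norm (by simpa using hN)
  refine ⟨(∫⁻ x : Rn n, ENNReal.ofReal ((1 + ‖x‖) ^ (-N))).toReal, ENNReal.toReal_nonneg, ?_⟩
  rw [ENNReal.ofReal_toReal h1.ne]
  refine lintegral_mono fun x => ENNReal.ofReal_le_ofReal ?_
  have : (1:ℝ) ≤ Real.exp 1 := Real.one_le_exp (by norm_num)
  have hN0 : 0 < N := lt_of_le_of_lt (Nat.cast_nonneg n) hN
  exact Real.rpow_le_rpow_of_nonpos (by positivity) (by linarith) (by linarith)

lemma one_le_eplus {n : ℕ} (x : Rn n) : 1 ≤ Real.exp 1 + ‖x‖ := by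
  have : (1:ℝ) ≤ Real.exp 1 := Real.one_le_exp (by norm_num)
  linarith [norm_nonneg x]

lemma low_large {n : ℕ} (p : Rn n → ℝ) {pm pinf K : ℝ} (hpm : 0 < pm) (hpmle : ∀ x, pm ≤ p x)
    (hpi : pm ≤ pinf) (hK : ∀ x, |p x - pinf| * Real.log (Real.exp 1 + ‖x‖) ≤ K) :
    ∃ c : ℝ, 0 < c ∧ ∀ (z : Rn n) (r l : ℝ), 1 ≤ r → 0 < l →
      ∫⁻ x in cube z r, ENNReal.ofReal (l ^ (-(p x))) ≤ 1 → c * r ^ (n / pinf) ≤ l := by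
  set M : ℝ := (n + 1) / pm with hM
  have hMpos : 0 < M := by positivity
  have hMpm : M * pm = n + 1 := by rw [hM]; field_simp
  obtain ⟨B, hB0, hB⟩ := tail_int (n := n) (N := M * pm) (by rw [hMpm]; linarith)
  have hpi0 : 0 < pinf := by linarith
  set B' : ℝ := Real.exp (M * K) + B with hB'
  have hB'0 : 0 < B' := by positivity
  refine ⟨(B' ^ (1 / pinf))⁻¹, by positivity, ?_⟩
  intro z r l hr hl hint
  have hr0 : 0 < r := by linarith
  have hl1 : 1 ≤ l := by
    by_contra! hlt
    have h1 : ∫⁻ x in cube z r, ENNReal.ofReal (l ^ (-pm)) ≤ 1 := by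
      refine (setLIntegral_mono' (cube_meas z r) fun x _ => ENNReal.ofReal_le_ofReal ?_).trans hint
      exact Real.rpow_le_rpow_of_exponent_ge hl hlt.le (by linarith [hpmle x])
    rw [setLIntegral_const, cube_vol z hr0.le, ← ENNReal.ofReal_mul (by positivity), ENNReal.ofReal_le_one] at h1
    have h2 : 1 < l ^ (-pm) := Real.one_lt_rpow_of_pos_of_lt_one_of_neg hl hlt (by linarith)
    have h3 : 1 ≤ r ^ n := one_le_pow₀ hr
    nlinarith
  have hpt : ∀ x, (l⁻¹) ^ pinf ≤ Real.exp (M * K) * l ^ (-(p x)) + (Real.exp 1 + ‖x‖) ^ (-(M * pm)) := by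
    intro x
    have := tinf (t := l⁻¹) (e1 := pinf) (e2 := p x) (em := pm) (K := K) (by positivity) (inv_le_one_of_one_le₀ hl1) hMpos
      (one_le_eplus x) hpm.le hpi (by rw [abs_sub_comm]; exact hK x)
    rwa [Real.inv_rpow hl.le (p x), ← Real.rpow_neg hl.le] at this
  have h5 : ∫⁻ x in cube z r, ENNReal.ofReal ((l⁻¹) ^ pinf) ≤ ENNReal.ofReal B' := by
    calc _ ≤ ∫⁻ x in cube z r, (ENNReal.ofReal (Real.exp (M * K)) * ENNReal.ofReal (l ^ (-(p x))) +
            ENNReal.ofReal ((Real.exp 1 + ‖x‖) ^ (-(M * pm)))) := by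
          refine lintegral_mono fun x => ?_
          rw [← ENNReal.ofReal_mul (by positivity), ← ENNReal.ofReal_add (by positivity)
            (by have := one_le_eplus x; positivity)]
          exact ENNReal.ofReal_le_ofReal (hpt x)
      _ ≤ ENNReal.ofReal (Real.exp (M * K)) * 1 + ENNReal.ofReal B := by
          rw [lintegral_add_right _ (by fun_prop), lintegral_const_mul' _ _ ENNReal.ofReal_ne_top]
          gcongr
          exact (setLIntegral_le_lintegral _ _).trans hB
      _ = _ := by rw [mul_one, ← ENNReal.ofReal_add (by positivity) hB0]
  rw [setLIntegral_const, cube_vol z hr0.le, ← ENNReal.ofReal_mul (by positivity),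
    ENNReal.ofReal_le_ofReal_iff hB'0.le, Real.inv_rpow hl.le, inv_mul_le_iff₀ (by positivity)] at h5
  have h6 := Real.rpow_le_rpow (by positivity) h5 (by positivity : 0 ≤ 1 / pinf)
  rw [Real.mul_rpow (by positivity) hB'0.le, ← Real.rpow_mul hl.le, mul_one_div_cancel hpi0.ne', Real.rpow_one,
    ← Real.rpow_natCast, ← Real.rpow_mul hr0.le, mul_one_div] at h6
  rw [inv_mul_le_iff₀ (by positivity), mul_comm]
  exact h6

lemma up_large {n : ℕ} (q : Rn n → ℝ) {qm qinf K : ℝ} (hqm : 0 < qm) (hqmle : ∀ x, qm ≤ q x)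
    (hqi : qm ≤ qinf) (hK : ∀ x, |q x - qinf| * Real.log (Real.exp 1 + ‖x‖) ≤ K) {L : ℝ} (hL : 0 < L) :
    ∃ κ : ℝ, 0 < κ ∧ ∀ (z : Rn n) (r l : ℝ), 1 ≤ r → κ * r ^ (n / qinf) ≤ l →
      ∫⁻ x in cube z (L * r), ENNReal.ofReal (l ^ (-(q x))) ≤ 1 := by
  set M : ℝ := (n + 1) / qm with hM
  have hMpos : 0 < M := by positivity
  have hMqm : M * qm = n + 1 := by rw [hM]; field_simp
  obtain ⟨B, hB0, hB⟩ := tail_int (n := n) (N := M * qm) (by rw [hMqm]; linarith)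
  have hqi0 : 0 < qinf := by linarith
  set B' : ℝ := max 1 (Real.exp (M * K) * L ^ n + B) with hB'
  have hB1 : 1 ≤ B' := le_max_left _ _
  set θ : ℝ := B' ^ (1 / qm) with hθ
  have hθ1 : 1 ≤ θ := Real.one_le_rpow hB1 (by positivity)
  have hθ2 : θ ^ qm = B' := by
    rw [hθ, ← Real.rpow_mul (by linarith)]; field_simp; simp
  refine ⟨θ, by positivity, ?_⟩
  intro z r l hr hle
  have hr0 : 0 < r := by linarith
  have hrn : 1 ≤ r ^ (n / qinf) := Real.one_le_rpow hr (by positivity)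
  set t : ℝ := (r ^ (n / qinf))⁻¹ with ht
  have ht0 : 0 < t := by positivity
  have ht1 : t ≤ 1 := inv_le_one_of_one_le₀ hrn
  have htq : t ^ qinf = (r ^ n)⁻¹ := by
    rw [ht, Real.inv_rpow (by positivity), ← Real.rpow_mul hr0.le, div_mul_cancel₀ _ hqi0.ne', Real.rpow_natCast]
  have hpt : ∀ x, l ^ (-(q x)) ≤ B'⁻¹ * (Real.exp (M * K) * (r ^ n)⁻¹ + (Real.exp 1 + ‖x‖) ^ (-(M * qm))) := by
    intro x
    have h1 := tinf (t := t) (e1 := q x) (e2 := qinf) (em := qm) ht0 ht1 hMpos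
      (one_le_eplus x) hqm.le (hqmle x) (hK x)
    rw [htq] at h1
    have h5 := Real.rpow_le_rpow_of_nonpos (by positivity) hle (by linarith [hqmle x] : -(q x) ≤ 0)
    refine h5.trans ?_
    rw [Real.mul_rpow (by positivity) (by positivity)]
    have e : (r ^ ((n:ℝ) / qinf)) ^ (-(q x)) = t ^ (q x) := by
      rw [ht, Real.inv_rpow (by positivity), Real.rpow_neg (by positivity)]
    rw [e]
    apply mul_le_mul _ h1 (by positivity) (by positivity)
    rw [← hθ2, ← Real.rpow_neg (by linarith)]
    exact Real.rpow_le_rpow_of_exponent_le hθ1 (by linarith [hqmle x])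
  calc _ ≤ ∫⁻ x in cube z (L * r), ENNReal.ofReal B'⁻¹ * (ENNReal.ofReal (Real.exp (M * K) * (r ^ n)⁻¹) +
            ENNReal.ofReal ((Real.exp 1 + ‖x‖) ^ (-(M * qm)))) := by
          refine lintegral_mono fun x => ?_
          rw [← ENNReal.ofReal_add (by positivity)
            (by have := one_le_eplus x; positivity), ← ENNReal.ofReal_mul (by positivity)]
          exact ENNReal.ofReal_le_ofReal (hpt x)
    _ ≤ ENNReal.ofReal B'⁻¹ * (ENNReal.ofReal (Real.exp (M * K) * L ^ n) + ENNReal.ofReal B) := by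
          rw [lintegral_const_mul' _ _ ENNReal.ofReal_ne_top, lintegral_add_right _ (by fun_prop)]
          gcongr
          · rw [setLIntegral_const, cube_vol z (by positivity), ← ENNReal.ofReal_mul (by positivity)]
            apply ENNReal.ofReal_le_ofReal
            apply le_of_eq; rw [mul_pow]; field_simp
          · exact (setLIntegral_le_lintegral _ _).trans hB
    _ = ENNReal.ofReal (B'⁻¹ * (Real.exp (M * K) * L ^ n + B)) := by
          rw [← ENNReal.ofReal_add (by positivity) hB0, ← ENNReal.ofReal_mul (by positivity)]
    _ ≤ 1 := by
          rw [ENNReal.ofReal_le_one, inv_mul_le_iff₀ (by positivity), mul_one]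
          exact le_max_right _ _

lemma pinf_ge {n : ℕ} (hn : 0 < n) (p : Rn n → ℝ) {pm C pinf : ℝ} (hC : 0 < C) (hpmle : ∀ x, pm ≤ p x)
    (h : ∀ x : Rn n, |p x - pinf| ≤ C / Real.log (Real.exp 1 + ‖x‖)) (ε : ℝ) (hε : 0 < ε) :
    ∃ x, |p x - pinf| ≤ ε := by
  have : Nonempty (Fin n) := ⟨⟨0, hn⟩⟩
  obtain ⟨x, hx⟩ := NormedSpace.exists_lt_norm ℝ (Rn n) (Real.exp (C / ε))
  refine ⟨x, (h x).trans ?_⟩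
  have h1 : C / ε ≤ Real.log (Real.exp 1 + ‖x‖) := by
    rw [Real.le_log_iff_exp_le (by positivity)]
    linarith [Real.exp_pos 1]
  rw [div_le_iff₀ (lt_of_lt_of_le (by positivity) h1)]
  rw [div_le_iff₀ hε] at h1
  linarith

lemma var_main {n : ℕ} (hn : 0 < n) {ι : Type} (Am : ι → Rn n → Rn n)
    (α : ℝ) (hα0 : 0 ≤ α)
    (p q : Rn n → ℝ) (hploc : LogHolderLocal p) (hpinf : LogHolderInfty p)
    (pm pp : ℝ) (hpm : 0 < pm) (hpmle : ∀ x, pm ≤ p x) (hple : ∀ x, p x ≤ pp)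
    (hpp : pp * α < n) (hpA : ∀ i, ∀ x : Rn n, p (Am i x) = p x)
    (hq : ∀ x, 1 / q x = 1 / p x - α / n) {L : ℝ} (hL : 0 < L) :
    ∃ k : ℝ, 0 < k ∧ ∀ (z : Rn n) (r : ℝ) (i : ι), 0 < r →
      varLpNorm q (cubeInd (Am i z) (L * r)) ≤ ENNReal.ofReal (k * r ^ (-α)) * varLpNorm p (cubeInd z r) := by
  have hnR : (0:ℝ) < n := by exact_mod_cast hn
  have hp0 : ∀ x, 0 < p x := fun x => hpm.trans_le (hpmle x)
  have hpppos : 0 < pp := (hp0 0).trans_le (hple 0)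
  set δ : ℝ := 1 / pp - α / n with hδ
  have hδ0 : 0 < δ := by
    rw [hδ, sub_pos, div_lt_div_iff₀ hnR hpppos]; linarith
  have hαn : 0 ≤ α / n := by positivity
  have hqgen : ∀ P Q : ℝ, pm ≤ P → P ≤ pp → 1 / Q = 1 / P - α / n → pm ≤ Q ∧ Q ≤ 1 / δ := by
    intro P Q h1 h2 h3
    have hP : 0 < P := hpm.trans_le h1
    have h4 : δ ≤ 1 / Q := by
      rw [h3, hδ]
      have := one_div_le_one_div_of_le hP h2
      linarith
    have hQ : 0 < Q := one_div_pos.1 (hδ0.trans_le h4)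
    have h5 : 1 / Q ≤ 1 / pm := by
      have := one_div_le_one_div_of_le hpm h1
      linarith
    refine ⟨(one_div_le_one_div hQ hpm).1 h5, ?_⟩
    rw [le_div_iff₀ hδ0]
    rw [le_div_iff₀ hQ] at h4; linarith
  have hqb := fun x => hqgen (p x) (q x) (hpmle x) (hple x) (hq x)
  have hqmle : ∀ x, pm ≤ q x := fun x => (hqb x).1
  have hq0 : ∀ x, 0 < q x := fun x => hpm.trans_le (hqmle x)
  have hqA : ∀ i z, 1 / q (Am i z) = 1 / q z := fun i z => by rw [hq, hq, hpA]
  -- infinity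
  obtain ⟨C, hC, pinf, hinf⟩ := hpinf
  have hpi1 : pm ≤ pinf := by
    by_contra! hlt
    obtain ⟨x, hx⟩ := pinf_ge hn p hC hpmle hinf ((pm - pinf) / 2) (by linarith)
    have := (abs_le.1 hx).2
    linarith [hpmle x]
  have hpi2 : pinf ≤ pp := by
    by_contra! hlt
    obtain ⟨x, hx⟩ := pinf_ge hn p hC hpmle hinf ((pinf - pp) / 2) (by linarith)
    have := (abs_le.1 hx).1
    linarith [hple x]
  have hpi0 : 0 < pinf := by linarith
  set qinf : ℝ := 1 / (1 / pinf - α / n) with hqinf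
  have hqi : 1 / qinf = 1 / pinf - α / n := by rw [hqinf, one_div_one_div]
  obtain ⟨hqi1, hqi2⟩ := hqgen pinf qinf hpi1 hpi2 hqi
  have hqi0 : 0 < qinf := by linarith
  have hlogpos : ∀ x : Rn n, 0 < Real.log (Real.exp 1 + ‖x‖) := fun x => by
    apply Real.log_pos
    have := Real.add_one_lt_exp (one_ne_zero : (1:ℝ) ≠ 0)
    linarith [norm_nonneg x]
  have hKp : ∀ x, |p x - pinf| * Real.log (Real.exp 1 + ‖x‖) ≤ C := fun x => by
    have := hinf x
    rwa [le_div_iff₀ (hlogpos x)] at this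
  have hKq : ∀ x, |q x - qinf| * Real.log (Real.exp 1 + ‖x‖) ≤ (1 / δ) ^ 2 / pm ^ 2 * C := fun x => by
    have e : q x - qinf = (p x - pinf) * (q x * qinf) / (p x * pinf) := by
      have e1 : q x - qinf = (1 / qinf - 1 / q x) * (q x * qinf) := by
        have := hq0 x; field_simp
      rw [e1, hqi, hq]
      have := hp0 x
      field_simp
      ring
    have h1 : |q x - qinf| ≤ (1 / δ) ^ 2 / pm ^ 2 * |p x - pinf| := by
      rw [e, abs_div, abs_mul, abs_of_pos (mul_pos (hq0 x) hqi0), abs_of_pos (mul_pos (hp0 x) hpi0)]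
      have a1 : q x * qinf ≤ (1 / δ) ^ 2 := by
        rw [sq]; exact mul_le_mul (hqb x).2 hqi2 hqi0.le (by positivity)
      have a2 : pm ^ 2 ≤ p x * pinf := by
        rw [sq]; exact mul_le_mul (hpmle x) hpi1 hpm.le (hp0 x).le
      calc |p x - pinf| * (q x * qinf) / (p x * pinf) ≤ |p x - pinf| * (1 / δ) ^ 2 / pm ^ 2 := by gcongr
        _ = _ := by ring
    calc _ ≤ (1 / δ) ^ 2 / pm ^ 2 * |p x - pinf| * Real.log (Real.exp 1 + ‖x‖) :=
          mul_le_mul_of_nonneg_right h1 (hlogpos x).le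
      _ = (1 / δ) ^ 2 / pm ^ 2 * (|p x - pinf| * Real.log (Real.exp 1 + ‖x‖)) := by ring
      _ ≤ _ := mul_le_mul_of_nonneg_left (hKp x) (by positivity)
  obtain ⟨K1, hK1, ho1⟩ := osc hn p hploc hpm hpmle (L := 1) one_pos
  obtain ⟨K2, hK2, ho2⟩ := osc hn p hploc hpm hpmle hL
  obtain ⟨κ1, hκ1, hu1⟩ := up_small (n := n) q hpm hqmle (K := K2) hL
  obtain ⟨c2, hc2, hl2⟩ := low_large p hpm hpmle hpi1 hKp
  obtain ⟨κ2, hκ2, hu2⟩ := up_large q hpm hqmle hqi1 hKq hL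
  set c1 : ℝ := 1 / 2 * Real.exp (-(n * K1)) with hc1
  have hc1p : 0 < c1 := by positivity
  set k : ℝ := κ1 / c1 + κ2 / c2 with hk
  have hk0 : 0 < k := by positivity
  refine ⟨k, hk0, fun z r i hr => ?_⟩
  have hkr : 0 < k * r ^ (-α) := by positivity
  have hpw : ∀ P Q : ℝ, 1 / Q = 1 / P - α / n → r ^ (-α) * r ^ (n / P) = r ^ (n / Q) := by
    intro P Q h
    rw [← Real.rpow_add hr]
    congr 1
    have : (n:ℝ) / Q = n * (1 / Q) := by ring
    rw [this, h]; field_simp; ring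
  have main : ∀ l : ℝ, 0 < l → ∫⁻ x in cube z r, ENNReal.ofReal (l ^ (-(p x))) ≤ 1 →
      ∫⁻ x in cube (Am i z) (L * r), ENNReal.ofReal ((k * r ^ (-α) * l) ^ (-(q x))) ≤ 1 := by
    intro l hl hint
    rcases le_total r 1 with hr1 | hr1
    · apply hu1 (Am i z) r _ hr _ hr1
      · have h1 := low_small p hpm hpmle hr (K := K1)
          (fun x hx => ho1 z r hr hr1 x (by rwa [one_mul])) hr1 hl hint
        have e : (n:ℝ) / q (Am i z) = n / q z := by
          have := hqA i z
          rw [← mul_one_div, this, mul_one_div]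
        rw [e, ← hpw (p z) (q z) (hq z)]
        have h2 : κ1 / c1 ≤ k := by
          have : 0 < κ2 / c2 := by positivity
          linarith
        calc κ1 * (r ^ (-α) * r ^ (n / p z)) = κ1 / c1 * r ^ (-α) * (c1 * r ^ (n / p z)) := by field_simp
          _ ≤ k * r ^ (-α) * l := by gcongr
      · intro x hx
        have := ho2 (Am i z) r hr hr1 x hx
        have e : 1 / q x - 1 / q (Am i z) = 1 / p x - 1 / p (Am i z) := by rw [hq, hq]; ring
        rw [e]; exact this
    · apply hu2 (Am i z) r _ hr1
      have h1 := hl2 z r l hr1 hl hint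
      rw [← hpw pinf qinf hqi]
      have h2 : κ2 / c2 ≤ k := by
        have : 0 < κ1 / c1 := by positivity
        linarith
      calc κ2 * (r ^ (-α) * r ^ (n / pinf)) = κ2 / c2 * r ^ (-α) * (c2 * r ^ (n / pinf)) := by field_simp
        _ ≤ k * r ^ (-α) * l := by gcongr
  rw [mul_comm (ENNReal.ofReal _), ← ENNReal.div_le_iff (by simpa using hkr) ENNReal.ofReal_ne_top]
  unfold varLpNorm varLpNormE
  apply le_sInf
  rintro _ ⟨l, hl, rfl, hint⟩
  rw [modular_eq p hp0 z r hl] at hint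
  rw [ENNReal.div_le_iff (by simpa using hkr) ENNReal.ofReal_ne_top, ← ENNReal.ofReal_mul hl.le]
  apply sInf_le
  refine ⟨l * (k * r ^ (-α)), by positivity, rfl, ?_⟩
  rw [modular_eq q hq0 _ _ (by positivity), mul_comm l]
  exact main l hl hint

theorem Talpha_atom_local_Lq0_bound
    {n m : ℕ} (hn : 0 < n) (hm : 1 < m)
    (A : Fin m → Matrix (Fin n) (Fin n) ℝ) (hA : ∀ i, IsUnit (A i))
    (hAij : ∀ i j, i ≠ j → IsUnit (A i - A j))
    (α : ℝ) (hα0 : 0 ≤ α) (hαn : α < n)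
    (αe : Fin m → ℝ) (hαe : ∀ i, 0 < αe i) (hsum : ∑ i, αe i = (n : ℝ) - α)
    (p q : Rn n → ℝ) (hploc : LogHolderLocal p) (hpinf : LogHolderInfty p)
    (pm pp : ℝ) (hpm : 0 < pm) (hpmle : ∀ x, pm ≤ p x) (hple : ∀ x, p x ≤ pp)
    (hpp : pp * α < n)
    (hpA : ∀ i, ∀ x : Rn n, p (mApp (A i) x) = p x)
    (hq : ∀ x, 1 / q x = 1 / p x - α / n)
    (p₀ q₀ : ℝ) (hp₀1 : 1 < p₀) (hp₀p : pp < p₀) (hp₀n : p₀ * α < n)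
    (hq₀ : 1 / q₀ = 1 / p₀ - α / n)
    (d : ℕ) (hd : dIndex n (pLow p) ≤ d) :
    ∃ C > 0, ∀ (a : Rn n → ℝ) (z : Rn n) (r : ℝ), 0 < r → IsPAtom p p₀ d a z r →
      ∀ i : Fin m,
      eLpNorm (Tα A αe a) (ENNReal.ofReal q₀)
          (volume.restrict (cube (mApp (A i) z) (4 * (⨆ i, opNorm (A i)) * r))) ≤
        ENNReal.ofReal (C *
            (volume (cube (mApp (A i) z) (4 * (⨆ i, opNorm (A i)) * r))).toReal ^ (1 / q₀)) /
          varLpNorm q (cubeInd (mApp (A i) z) (4 * (⨆ i, opNorm (A i)) * r)) := by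
  have hnR : (0:ℝ) < n := by exact_mod_cast hn
  have hne : Nonempty (Fin n) := ⟨⟨0, hn⟩⟩
  have hp0 : 0 < p₀ := by linarith
  have hq0 : 0 < q₀ := by
    apply one_div_pos.1
    rw [hq₀, sub_pos, div_lt_div_iff₀ hnR hp0]; linarith
  set D : ℝ := ⨆ i, opNorm (A i) with hD
  have hD0 : 0 < D := by
    let i0 : Fin m := ⟨0, by omega⟩
    have h1 : opNorm (A i0) ≤ D := le_ciSup (f := fun i => opNorm (A i)) (Set.finite_range _).bddAbove i0
    refine lt_of_lt_of_le ?_ h1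
    obtain ⟨c, hc, h⟩ := mApp_lower (A i0) (hA i0)
    obtain ⟨x, hx⟩ := exists_ne (0 : Rn n)
    have hx' := norm_pos_iff.2 hx
    have h2 := (h x).trans (mApp_le (A i0) x)
    nlinarith [mul_pos hc hx']
  obtain ⟨Ch, hCh, hH⟩ := HLS hn hm A hA hAij α hα0 hαn αe hαe hsum p₀ q₀ hp₀1 hq0 hq₀
  obtain ⟨k, hk, hV⟩ := var_main hn (fun i => mApp (A i)) α hα0 p q hploc hpinf pm pp hpm hpmle hple hpp hpA hq
    (L := 4 * D) (by positivity)
  set c0 : ℝ := Ch.toReal + 1 with hc0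
  have hc00 : 0 < c0 := by positivity
  refine ⟨c0 * k * ((4 * D) ^ ((n:ℝ) / q₀))⁻¹, by positivity, fun a z r hr ha i => ?_⟩
  have h1 : eLpNorm (Tα A αe a) (ENNReal.ofReal q₀) volume ≤ ENNReal.ofReal c0 * eLpNorm a (ENNReal.ofReal p₀) volume := by
    by_cases hfin : eLpNorm a (ENNReal.ofReal p₀) volume = ⊤
    · rw [hfin, ENNReal.mul_top (by simpa using hc00)]; exact le_top
    · refine (hH a ha.measurable hfin).trans (mul_le_mul_left ?_ _)
      rw [← ENNReal.ofReal_toReal hCh]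
      exact ENNReal.ofReal_le_ofReal (by linarith)
  have h2 : ∀ X : ℝ, 0 ≤ X → ENNReal.ofReal X / varLpNorm p (cubeInd z r) ≤
      ENNReal.ofReal (X * (k * r ^ (-α))) / varLpNorm q (cubeInd (mApp (A i) z) (4 * D * r)) := by
    intro X hX
    have hkr : 0 < k * r ^ (-α) := by positivity
    rw [ENNReal.ofReal_mul hX, mul_comm (ENNReal.ofReal X)]
    refine le_trans (le_of_eq ?_) (ENNReal.div_le_div_left (hV z r i hr) _)
    rw [ENNReal.mul_div_mul_left _ _ (by simpa using hkr) ENNReal.ofReal_ne_top]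
  refine (eLpNorm_mono_measure _ Measure.restrict_le_self).trans (h1.trans ?_)
  refine (mul_le_mul_right (ha.size.trans (h2 _ (by positivity))) _).trans ?_
  rw [← mul_div_assoc, ← ENNReal.ofReal_mul hc00.le]
  refine ENNReal.div_le_div_right (ENNReal.ofReal_le_ofReal (le_of_eq ?_)) _
  rw [cube_vol _ hr.le, cube_vol _ (by positivity), ENNReal.toReal_ofReal (by positivity),
    ENNReal.toReal_ofReal (by positivity), ← Real.rpow_natCast, ← Real.rpow_natCast, ← Real.rpow_mul hr.le,
    ← Real.rpow_mul (by positivity), mul_one_div, mul_one_div, Real.mul_rpow (by positivity) hr.le]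
  have e : r ^ ((n:ℝ) / q₀) = r ^ ((n:ℝ) / p₀) * r ^ (-α) := by
    rw [← Real.rpow_add hr]
    congr 1
    have : (n:ℝ) / q₀ = n * (1 / q₀) := by ring
    rw [this, hq₀]; field_simp; ring
  rw [e]
  field_simp
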